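/- Let A be a finite-dimensional basic algebra over an algebraically closed field k with radical r and a complete set of primitive orthogonal idempotents ε₁,…,ε_n with 1 = ε₁ + ⋯ + ε_n. Then for the simple modules S_i = Aε_i/rε_i, one has dim_k Ext¹_A(S_i, S_j) = dim_k (ε_j (r/r²) ε_i). -/

import Mathlib

open CategoryTheory

theorem finrank_homology_eq {k : Type*} [Field k] (T : ShortComplex (ModuleCat.{0} k))
    {H : Type*} [AddCommGroup H] [Module k H] (ψ : H →ₗ[k] T.X₂)
    (hcycle : ∀ h, T.g (ψ h) = 0) (hinj : ∀ h x, ψ h = T.f x → h = 0)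
    (hsurj : ∀ y, T.g y = 0 → ∃ h x, y = ψ h + T.f x) :
    Module.finrank k T.homology = Module.finrank k H := by
  rw [T.moduleCatHomologyIso.toLinearEquiv.finrank_eq]
  let ψ' : H →ₗ[k] LinearMap.ker T.g.hom := ψ.codRestrict _ hcycle
  let Ψ : H →ₗ[k] LinearMap.ker T.g.hom ⧸ LinearMap.range T.moduleCatToCycles :=
    (Submodule.mkQ _).comp ψ'
  refine (LinearEquiv.ofBijective Ψ ⟨?_, ?_⟩).symm.finrank_eq
  · rw [injective_iff_map_eq_zero]
    intro h hh
    obtain ⟨x, hx⟩ := (Submodule.Quotient.mk_eq_zero _).1 hh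
    exact hinj h x (congrArg Subtype.val hx).symm
  · intro y
    obtain ⟨⟨y, hy⟩, rfl⟩ := Submodule.mkQ_surjective _ y
    obtain ⟨h, x, rfl⟩ := hsurj y hy
    refine ⟨h, ?_⟩
    refine ((Submodule.Quotient.eq _).2 ⟨-x, Subtype.ext ?_⟩)
    change T.f (-x) = ψ h - (ψ h + T.f x)
    simp

/-- If `0 → K → P → S → 0` is exact with `P` projective and every morphism `P ⟶ N` vanishes on `K`,
then `Ext¹(S, N)` and `Hom(K, N)` have the same dimension. -/
theorem finrank_ext_one_eq {k A : Type} [Field k] [Ring A] [Algebra k A]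
    {K P S N : ModuleCat.{0} A} [Projective P] (i : K ⟶ P) (p : P ⟶ S)
    (hi : Function.Injective i) (hip : Function.Exact i p) (hp : Function.Surjective p)
    (hN : ∀ f : P ⟶ N, i ≫ f = 0) :
    Module.finrank k (((Ext k (ModuleCat.{0} A) 1).obj (Opposite.op S)).obj N) =
      Module.finrank k (K ⟶ N) := by
  let R := ProjectiveResolution.of S
  let π : R.complex.X 0 ⟶ S := R.π.f 0
  have hepi : Epi π := inferInstanceAs (Epi (R.π.f 0))
  have hepi' : Epi p := (ModuleCat.epi_iff_surjective p).2 hp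
  have hmono : Mono i := (ModuleCat.mono_iff_injective i).2 hi
  have hip0 : i ≫ p = 0 := by ext x; exact hip.apply_apply_eq_zero x
  let E : ShortComplex (ModuleCat.{0} A) := ShortComplex.mk i p hip0
  have hE : E.Exact := (ShortComplex.ShortExact.moduleCat_exact_iff_function_exact E).2 hip
  let u : R.complex.X 0 ⟶ P := Projective.factorThru π p
  let v : P ⟶ R.complex.X 0 := Projective.factorThru p π
  have hu : u ≫ p = π := Projective.factorThru_comp _ _
  have hv : v ≫ π = p := Projective.factorThru_comp _ _
  have hdπ : R.complex.d 1 0 ≫ π = 0 := R.complex_d_comp_π_f_zero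
  let D₀ : ShortComplex (ModuleCat.{0} A) := ShortComplex.mk _ _ hdπ
  have hD₀ : D₀.Exact := R.exact₀
  let D₁ : ShortComplex (ModuleCat.{0} A) :=
    ShortComplex.mk _ _ (R.complex.d_comp_d 2 1 0)
  have hD₁ : D₁.Exact := R.exact_succ 0
  let ι := Limits.kernel.ι π
  let e : R.complex.X 1 ⟶ Limits.kernel π := Limits.kernel.lift π _ hdπ
  have he : e ≫ ι = R.complex.d 1 0 := Limits.kernel.lift_ι _ _ _
  have hι : ι ≫ π = 0 := Limits.kernel.condition π
  have : Epi e := D₀.exact_iff_epi_kernel_lift.1 hD₀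
  have hde : R.complex.d 2 1 ≫ e = 0 := by
    rw [← cancel_mono ι, Category.assoc, he]; simp
  let T : ShortComplex (ModuleCat.{0} A) := ShortComplex.mk _ _ hde
  have hT : T.Exact := by
    rw [ShortComplex.moduleCat_exact_iff] at hD₁ ⊢
    intro x hx
    refine hD₁ x ?_
    change R.complex.d 1 0 x = 0
    rw [← he, ModuleCat.comp_apply]
    exact (congrArg ι hx).trans (map_zero ι.hom)
  have hTe : Epi T.g := this
  obtain ⟨w, hw⟩ : ∃ w : Limits.kernel π ⟶ K, w ≫ i = ι ≫ u :=
    hE.lift' (ι ≫ u) (by simp [E, hu, hι])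
  obtain ⟨t, ht⟩ : ∃ t : P ⟶ K, t ≫ i = v ≫ u - 𝟙 P :=
    hE.lift' (v ≫ u - 𝟙 P) (by simp [E, hu, hv])
  obtain ⟨j, hj⟩ : ∃ j : K ⟶ Limits.kernel π, j ≫ ι = i ≫ v :=
    ⟨Limits.kernel.lift π (i ≫ v) (by simp [hv, hip0]), Limits.kernel.lift_ι _ _ _⟩
  obtain ⟨s, hs⟩ : ∃ s : R.complex.X 0 ⟶ Limits.kernel π, s ≫ ι = u ≫ v - 𝟙 _ :=
    ⟨Limits.kernel.lift π (u ≫ v - 𝟙 _) (by simp [hu, hv]), Limits.kernel.lift_ι _ _ _⟩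
  have hjw : j ≫ w = 𝟙 K + i ≫ t := by
    rw [← cancel_mono i, Category.assoc, hw, reassoc_of% hj]
    simp [ht]
  have hwj : w ≫ j = 𝟙 _ + ι ≫ s := by
    rw [← cancel_mono ι, Category.assoc, hj, reassoc_of% hw]
    simp [hs]
  rw [((R.isoExt 1 N).toLinearEquiv).finrank_eq,
    ((R.complex.linearYonedaObj k N).homologyIsoSc' 0 1 2 (by simp) (by simp)).toLinearEquiv.finrank_eq]
  refine finrank_homology_eq _ (Linear.leftComp k N (e ≫ w)) ?_ ?_ ?_
  · intro h
    change R.complex.d 2 1 ≫ (e ≫ w) ≫ h = 0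
    simp [reassoc_of% hde]
  · intro h (g : R.complex.X 0 ⟶ N) (hg : (e ≫ w) ≫ h = R.complex.d 1 0 ≫ g)
    rw [← he, Category.assoc, Category.assoc, cancel_epi] at hg
    have h1 : j ≫ w ≫ h = h := by
      rw [reassoc_of% hjw]
      simp [hN]
    rw [← h1, hg, reassoc_of% hj, hN]
  · intro (f : R.complex.X 1 ⟶ N) (hf : R.complex.d 2 1 ≫ f = 0)
    obtain ⟨f', rfl⟩ : ∃ f' : Limits.kernel π ⟶ N, e ≫ f' = f := hT.desc' f hf
    refine ⟨j ≫ f', -(s ≫ f'), ?_⟩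
    change e ≫ f' = (e ≫ w) ≫ j ≫ f' + R.complex.d 1 0 ≫ (-(s ≫ f'))
    rw [← he, Category.assoc, reassoc_of% hwj]
    simp

/-- `e` is a primitive idempotent: nonzero and not a sum of two nonzero orthogonal idempotents. -/
structure IsPrimitiveIdem {A : Type*} [Ring A] (e : A) : Prop where
  idem : IsIdempotentElem e
  ne_zero : e ≠ 0
  split : ∀ f g : A, IsIdempotentElem f → IsIdempotentElem g →
    f * g = 0 → g * f = 0 → f + g = e → f = 0 ∨ g = 0

section Corner

variable {k A : Type*} [Field k] [Ring A] [Algebra k A] {e : A}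

theorem mem_span_idem_iff (he : IsIdempotentElem e) {x : A} :
    x ∈ (Ideal.span {e} : Ideal A) ↔ x * e = x := by
  rw [Ideal.mem_span_singleton']
  constructor
  · rintro ⟨a, rfl⟩
    rw [mul_assoc, he.eq]
  · exact fun h => ⟨x, h⟩

/-- The left ideal generated by a primitive idempotent is indecomposable. -/
theorem IsPrimitiveIdem.eq_top_of_isCompl (he : IsPrimitiveIdem e)
    {M N : Submodule A (Ideal.span {e} : Ideal A)} (h : IsCompl M N) : M = ⊤ ∨ N = ⊤ := by
  have hmem {x : A} := mem_span_idem_iff he.idem (x := x)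
  have key {M N : Submodule A (Ideal.span {e} : Ideal A)} (h : Disjoint M N)
      (f g : (Ideal.span {e} : Ideal A)) (hf : f ∈ M) (hg : g ∈ N) (hfg : (f : A) + g = e) :
      (f : A) * f = f ∧ (f : A) * g = 0 := by
    have h1 : (f : A) = f * f + f * g := by rw [← mul_add, hfg, hmem.1 f.2]
    have h2 : (f : A) • g = f - (f : A) • f := by
      ext
      simp only [Submodule.coe_sub, Submodule.coe_smul, smul_eq_mul]
      exact eq_sub_of_add_eq (by rw [add_comm]; exact h1.symm)
    have h3 : (f : A) • g = 0 :=
      (Submodule.disjoint_def.1 h) _ (h2 ▸ M.sub_mem hf (M.smul_mem _ hf)) (N.smul_mem _ hg)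
    have h4 : (f : A) * g = 0 := congrArg Subtype.val h3
    exact ⟨by rw [h4, add_zero] at h1; exact h1.symm, h4⟩
  have htop {M : Submodule A (Ideal.span {e} : Ideal A)}
      (hM : (⟨e, Ideal.mem_span_singleton_self e⟩ : (Ideal.span {e} : Ideal A)) ∈ M) : M = ⊤ := by
    refine eq_top_iff.2 fun x _ => ?_
    have : x = (x : A) • (⟨e, Ideal.mem_span_singleton_self e⟩ : (Ideal.span {e} : Ideal A)) :=
      Subtype.ext (hmem.1 x.2).symm
    rw [this]
    exact M.smul_mem _ hM
  obtain ⟨f, hf, g, hg, hfg⟩ := Submodule.mem_sup.1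
    (h.sup_eq_top ▸ Submodule.mem_top :
      (⟨e, Ideal.mem_span_singleton_self e⟩ : (Ideal.span {e} : Ideal A)) ∈ M ⊔ N)
  have hfg' : (f : A) + g = e := congrArg Subtype.val hfg
  obtain ⟨hff, hfg0⟩ := key h.disjoint f g hf hg hfg'
  obtain ⟨hgg, hgf0⟩ := key h.disjoint.symm g f hg hf (by rw [add_comm, hfg'])
  rcases he.split f g hff hgg hfg0 hgf0 hfg' with h0 | h0
  · right
    apply htop
    rw [← hfg, show f = 0 from Subtype.ext h0, zero_add]
    exact hg
  · left
    apply htop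
    rw [← hfg, show g = 0 from Subtype.ext h0, add_zero]
    exact hf

/-- Right multiplication by an element of the corner `eAe` as an endomorphism of `Ae`. -/
def cornerMulRight (e u : A) (hu : u * e = u) :
    Module.End A (Ideal.span {e} : Ideal A) :=
  (LinearMap.toSpanSingleton A A u ∘ₗ (Ideal.span {e} : Ideal A).subtype).codRestrict _
    fun x => Ideal.mem_span_singleton'.2 ⟨x * u, by simp [mul_assoc, hu]⟩

@[simp]
theorem coe_cornerMulRight_apply (u : A) (hu : u * e = u) (x : (Ideal.span {e} : Ideal A)) :
    (cornerMulRight e u hu x : A) = x * u := rfl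

theorem coe_cornerMulRight_pow_apply (u : A) (hu : u * e = u) (n : ℕ)
    (x : (Ideal.span {e} : Ideal A)) : ((cornerMulRight e u hu ^ n) x : A) = x * u ^ n := by
  induction n generalizing x with
  | zero => simp
  | succ n ih => rw [pow_succ, Module.End.mul_apply, ih, coe_cornerMulRight_apply, mul_assoc,
      pow_succ']

theorem IsPrimitiveIdem.exists_isNilpotent_sub [IsAlgClosed k] [FiniteDimensional k A]
    (he : IsPrimitiveIdem e) {u : A} (hl : e * u = u) (hr : u * e = u) :
    ∃ c : k, IsNilpotent (u - c • e) := by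
  have hmem {x : A} := mem_span_idem_iff he.idem (x := x)
  have : IsArtinianRing A := IsArtinianRing.of_finite k A
  have : Nontrivial (Ideal.span {e} : Ideal A) :=
    ⟨⟨⟨e, Ideal.mem_span_singleton_self e⟩, 0, fun h => he.ne_zero (congrArg Subtype.val h)⟩⟩
  obtain ⟨c, hc⟩ := Module.End.exists_eigenvalue
    ((cornerMulRight e u hr).restrictScalars k : Module.End k (Ideal.span {e} : Ideal A))
  obtain ⟨x, hx, hx0⟩ := hc.exists_hasEigenvector
  have hxu : (x : A) * u = c • (x : A) :=
    congrArg Subtype.val (Module.End.mem_eigenspace_iff.1 hx)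
  refine ⟨c, ?_⟩
  have hv : (u - c • e) * e = u - c • e := by
    rw [sub_mul, hr, smul_mul_assoc, he.idem.eq]
  have hlv : e * (u - c • e) = u - c • e := by
    rw [mul_sub, hl, mul_smul_comm, he.idem.eq]
  set v := u - c • e with hvdef
  have hxv : (x : A) * v = 0 := by
    rw [hvdef, mul_sub, hxu, mul_smul_comm, hmem.1 x.2, sub_self]
  obtain ⟨n, hn⟩ := ((cornerMulRight e v hv).eventually_isCompl_ker_pow_range_pow.and
    (Filter.eventually_ge_atTop 1)).exists
  refine ⟨n, ?_⟩
  obtain ⟨hn, hn1⟩ := hn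
  have hpos : n ≠ 0 := by omega
  have hev : e * v ^ n = v ^ n := by
    obtain ⟨m, rfl⟩ := Nat.exists_eq_succ_of_ne_zero hpos
    rw [pow_succ', ← mul_assoc, hlv]
  rcases he.eq_top_of_isCompl hn with h | h
  · have := LinearMap.mem_ker.1 (h ▸ Submodule.mem_top :
      (⟨e, Ideal.mem_span_singleton_self e⟩ : (Ideal.span {e} : Ideal A)) ∈ _)
    have h2 := congrArg Subtype.val this
    rw [coe_cornerMulRight_pow_apply] at h2
    exact hev ▸ h2
  · exfalso
    have hd := hn.disjoint
    rw [h, disjoint_top] at hd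
    have hxk : x ∈ LinearMap.ker (cornerMulRight e v hv ^ n) := by
      rw [LinearMap.mem_ker]
      ext
      obtain ⟨m, rfl⟩ := Nat.exists_eq_succ_of_ne_zero hpos
      rw [coe_cornerMulRight_pow_apply, pow_succ', ← mul_assoc, hxv]
      simp
    rw [hd] at hxk
    exact hx0 ((Submodule.mem_bot A).1 hxk)

theorem IsPrimitiveIdem.isNilpotent_or_exists_mul_eq [IsAlgClosed k] [FiniteDimensional k A]
    (he : IsPrimitiveIdem e) {u : A} (hl : e * u = u) (hr : u * e = u) :
    IsNilpotent u ∨ ∃ y, u * y = e := by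
  obtain ⟨c, hc⟩ := he.exists_isNilpotent_sub (k := k) hl hr
  by_cases h0 : c = 0
  · left; simpa [h0] using hc
  right
  have hn : IsNilpotent (c⁻¹ • (u - c • e)) := hc.smul c⁻¹
  obtain ⟨y, hy⟩ := hn.isUnit_one_add.exists_right_inv
  refine ⟨c⁻¹ • (y * e), ?_⟩
  have : c⁻¹ • u = e * (1 + c⁻¹ • (u - c • e)) := by
    rw [mul_add, mul_one, mul_smul_comm, mul_sub, hl, mul_smul_comm, he.idem.eq, smul_sub,
      smul_smul, inv_mul_cancel₀ h0, one_smul]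
    abel
  rw [mul_smul_comm, ← smul_mul_assoc, ← mul_assoc, this, mul_assoc e, hy, mul_one, he.idem.eq]

theorem mem_jacobson_bot_of_forall_isNilpotent {a : A} (h : ∀ b, IsNilpotent (b * a)) :
    a ∈ (⊥ : Ideal A).jacobson := by
  rw [Ideal.mem_jacobson_iff]
  intro y
  obtain ⟨z, hz⟩ := (h y).isUnit_add_one.exists_left_inv
  refine ⟨z, ?_⟩
  rw [Ideal.mem_bot, mul_assoc]
  rw [mul_add, mul_one] at hz
  rw [hz, sub_self]

theorem IsPrimitiveIdem.exists_mul_eq_of_notMem_jacobson [IsAlgClosed k] [FiniteDimensional k A]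
    (he : IsPrimitiveIdem e) {a : A} (hl : e * a = a) (ha : a ∉ (⊥ : Ideal A).jacobson) :
    ∃ b, a * b = e := by
  by_contra! hb
  refine ha (mem_jacobson_bot_of_forall_isNilpotent fun b => ?_)
  rcases he.isNilpotent_or_exists_mul_eq (k := k) (u := a * b * e)
    (by rw [← mul_assoc, ← mul_assoc, hl]) (by rw [mul_assoc, he.idem.eq]) with ⟨m, hm⟩ | ⟨y, hy⟩
  · refine ⟨m + 1, ?_⟩
    have h1 : ∀ m : ℕ, (a * b * e) ^ m * a = a * (b * a) ^ m := by
      intro m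
      induction m with
      | zero => simp
      | succ m ih =>
        have h2 : a * b * e * a = a * (b * a) := by rw [mul_assoc, hl, mul_assoc]
        rw [pow_succ, mul_assoc, h2, ← mul_assoc, ih, mul_assoc, ← pow_succ]
    rw [pow_succ', mul_assoc, ← h1, hm, zero_mul, mul_zero]
  · exact (hb (b * e * y) (by simpa only [mul_assoc] using hy)).elim

theorem IsPrimitiveIdem.mem_jacobson_of_isNilpotent [IsAlgClosed k] [FiniteDimensional k A]
    (he : IsPrimitiveIdem e) {v : A} (hl : e * v = v) (hr : v * e = v) (hv : IsNilpotent v) :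
    v ∈ (⊥ : Ideal A).jacobson := by
  by_contra h
  obtain ⟨b, hb⟩ := he.exists_mul_eq_of_notMem_jacobson (k := k) hl h
  obtain ⟨n, hn⟩ := hv
  have key : ∀ n : ℕ, e * v ^ n * e = 0 → e = 0 := by
    intro n
    induction n with
    | zero => intro h; simpa [he.idem.eq] using h
    | succ n ih =>
      intro h
      refine ih ?_
      rw [pow_succ, mul_assoc, mul_assoc, hr] at h
      calc e * v ^ n * e = e * v ^ n * (v * b) := by rw [hb]
        _ = e * (v ^ n * v) * b := by simp only [mul_assoc]
        _ = 0 := by rw [h, zero_mul]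
  exact he.ne_zero (key n (by rw [hn]; simp))

theorem IsPrimitiveIdem.exists_sub_smul_mem_jacobson [IsAlgClosed k] [FiniteDimensional k A]
    (he : IsPrimitiveIdem e) (a : A) :
    ∃ c : k, e * a * e - c • e ∈ (⊥ : Ideal A).jacobson := by
  have h1 : e * (e * a * e) = e * a * e := by simp only [← mul_assoc, he.idem.eq]
  have h2 : e * a * e * e = e * a * e := by rw [mul_assoc, he.idem.eq]
  obtain ⟨c, hc⟩ := he.exists_isNilpotent_sub (k := k) h1 h2
  exact ⟨c, he.mem_jacobson_of_isNilpotent (k := k)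
    (by rw [mul_sub, h1, mul_smul_comm, he.idem.eq])
    (by rw [sub_mul, h2, smul_mul_assoc, he.idem.eq]) hc⟩

theorem IsPrimitiveIdem.notMem_jacobson (he : IsPrimitiveIdem e) :
    e ∉ (⊥ : Ideal A).jacobson := by
  intro h
  obtain ⟨z, hz⟩ := Ideal.mem_jacobson_iff.1 h (-1)
  rw [Ideal.mem_bot, sub_eq_zero] at hz
  have := congrArg (· * e) hz
  simp only [add_mul, mul_assoc, he.idem.eq] at this
  simp at this
  exact he.ne_zero this.symm

/-- If primitive idempotents `e`, `f` generate non-isomorphic left ideals, then `eAf` is contained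
in the radical. -/
theorem IsPrimitiveIdem.mul_mul_mem_jacobson [IsAlgClosed k] [FiniteDimensional k A]
    {f : A} (he : IsPrimitiveIdem e) (hf : IsPrimitiveIdem f)
    (hiso : IsEmpty ((Ideal.span {e} : Ideal A) ≃ₗ[A] (Ideal.span {f} : Ideal A))) (a : A) :
    e * a * f ∈ (⊥ : Ideal A).jacobson := by
  by_contra h
  have hea : e * (e * a * f) = e * a * f := by simp only [← mul_assoc, he.idem.eq]
  have haf : e * a * f * f = e * a * f := by rw [mul_assoc, hf.idem.eq]
  obtain ⟨b, hb⟩ := he.exists_mul_eq_of_notMem_jacobson (k := k) hea h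
  set x := e * a * f
  have hxy : x * (f * b * e) = e := by
    rw [← mul_assoc, ← mul_assoc, haf, hb, he.idem.eq]
  have hfy : f * (f * b * e) = f * b * e := by simp only [← mul_assoc, hf.idem.eq]
  have hye : f * b * e * e = f * b * e := by rw [mul_assoc, he.idem.eq]
  set y := f * b * e
  have hidem : y * x * (y * x) = y * x := by
    rw [mul_assoc, ← mul_assoc x, hxy, hea]
  have hfyx : f * (y * x) = y * x := by rw [← mul_assoc, hfy]
  have hyxf : y * x * f = y * x := by rw [mul_assoc, haf]
  have hyx : y * x = f := by
    rcases hf.split (y * x) (f - y * x) hidem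
      (by simp only [IsIdempotentElem, mul_sub, sub_mul, hfyx, hyxf, hidem, hf.idem.eq]; abel)
      (by rw [mul_sub, hyxf, hidem, sub_self]) (by rw [sub_mul, hfyx, hidem, sub_self])
      (by abel) with h0 | h0
    · refine absurd ?_ he.ne_zero
      rw [← he.idem.eq, ← hxy, mul_assoc, ← mul_assoc y, h0, zero_mul, mul_zero]
    · exact (sub_eq_zero.1 h0).symm
  have hme {z : A} := mem_span_idem_iff he.idem (x := z)
  have hmf {z : A} := mem_span_idem_iff hf.idem (x := z)
  refine hiso.false (LinearEquiv.ofLinearMap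
    ((LinearMap.toSpanSingleton A A x ∘ₗ (Ideal.span {e} : Ideal A).subtype).codRestrict _
      fun z => hmf.2 (by simp [mul_assoc, haf]))
    ((LinearMap.toSpanSingleton A A y ∘ₗ (Ideal.span {f} : Ideal A).subtype).codRestrict _
      fun z => hme.2 (by simp [mul_assoc, hye])) ?_ ?_)
  · ext z
    simp [mul_assoc, hyx, hmf.1 z.2]
  · ext z
    simp [mul_assoc, hxy, hme.1 z.2]

end Corner

section HomToSimple

variable {k A : Type*} [Field k] [Ring A] [Algebra k A]

/-- Let `S = k s` be a one-dimensional module with `f s = s` for an idempotent `f`, annihilated by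
the radical `J`, and let `K` be isomorphic to the left ideal `Je`. If `f` acts centrally modulo `J`,
then `Hom_A(K, S)` is dual to `fJe / fJ²e`. -/
theorem finrank_linearMap_eq_finrank_quotient {e f : A} (he : IsIdempotentElem e)
    (hf : IsIdempotentElem f)
    (hfa : ∀ a : A, ∃ c : k, f * a - c • f ∈ (⊥ : Ideal A).jacobson)
    {K S : Type*} [AddCommGroup K] [Module A K] [AddCommGroup S] [Module A S]
    [Module k S] [IsScalarTower k A S] [SMulCommClass A k S]
    (ι : K →ₗ[A] A) (hι : Function.Injective ι)
    (hrange : ∀ x, x ∈ LinearMap.range ι ↔ x ∈ (⊥ : Ideal A).jacobson ∧ x * e = x)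
    {s : S} (hs0 : s ≠ 0) (hspan : ∀ t : S, ∃ c : k, c • s = t)
    (hfs : f • s = s) (hJ : ∀ a ∈ (⊥ : Ideal A).jacobson, a • s = 0) :
    Module.finrank k (K →ₗ[A] S) =
      Module.finrank k
        (↥(Submodule.map (LinearMap.mulLeft k f ∘ₗ LinearMap.mulRight k e)
            (((⊥ : Ideal A).jacobson).restrictScalars k)) ⧸
          Submodule.comap
            (Submodule.map (LinearMap.mulLeft k f ∘ₗ LinearMap.mulRight k e)
              (((⊥ : Ideal A).jacobson).restrictScalars k)).subtype
            (Submodule.map (LinearMap.mulLeft k f ∘ₗ LinearMap.mulRight k e)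
              ((((⊥ : Ideal A).jacobson).restrictScalars k) ^ 2))) := by
  set J : Ideal A := (⊥ : Ideal A).jacobson
  set p : A →ₗ[k] A := LinearMap.mulLeft k f ∘ₗ LinearMap.mulRight k e
  have hp (x : A) : p x = f * (x * e) := rfl
  set W : Submodule k A := Submodule.map p (J.restrictScalars k)
  set W₂ : Submodule k W := Submodule.comap W.subtype (Submodule.map p (J.restrictScalars k ^ 2))
  have hιJ (x : K) : ι x ∈ J := ((hrange _).1 ⟨x, rfl⟩).1
  have hιe (x : K) : ι x * e = ι x := ((hrange _).1 ⟨x, rfl⟩).2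
  have hsk (c : k) (h : c • s = 0) : c = 0 := (smul_eq_zero.1 h).resolve_right hs0
  -- the `k`-linear map `K → fJe / fJ²e` induced by multiplication by `f`
  have hW (x : K) : f * ι x ∈ W := ⟨ι x, hιJ x, by rw [hp, hιe]⟩
  let q : K → W ⧸ W₂ := fun x => W₂.mkQ ⟨f * ι x, hW x⟩
  have hq_add (x y : K) : q (x + y) = q x + q y := by
    simp only [q, ← map_add]
    congr 1
    ext
    simp [mul_add]
  have hfsmul (a : A) : ∃ c : k, a • s = c • s ∧ f * a - c • f ∈ J := by
    obtain ⟨c, hc⟩ := hfa a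
    obtain ⟨d, hd⟩ := hspan (a • s)
    refine ⟨c, ?_, hc⟩
    have h1 := hJ _ hc
    rw [sub_smul, mul_smul, ← hd, smul_comm, hfs, smul_assoc, hfs, hd, sub_eq_zero] at h1
    exact h1
  have hq_smul (a : A) (c : k) (hc : f * a - c • f ∈ J) (x : K) : q (a • x) = c • q x := by
    simp only [q, ← map_smul]
    rw [← sub_eq_zero, ← map_sub]
    refine (Submodule.Quotient.mk_eq_zero _).2 ⟨(f * a - c • f) * ι x, ?_, ?_⟩
    · rw [pow_two]
      exact Submodule.mul_mem_mul hc (hιJ x)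
    · rw [hp, mul_assoc, hιe]
      simp [mul_sub, sub_mul, ← mul_assoc, hf.eq]
  let Ψ : Module.Dual k (W ⧸ W₂) →ₗ[k] (K →ₗ[A] S) :=
    { toFun := fun φ =>
        { toFun := fun x => φ (q x) • s
          map_add' := fun x y => by rw [hq_add, map_add, add_smul]
          map_smul' := fun a x => by
            obtain ⟨c, hc, hc'⟩ := hfsmul a
            rw [hq_smul a c hc', map_smul, RingHom.id_apply, smul_comm a, hc, smul_smul,
              smul_eq_mul, mul_comm] }
      map_add' := fun φ ψ => by ext x; simp [add_smul]
      map_smul' := fun c φ => by ext x; simp [mul_smul] }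
  have hΨ : Function.Bijective Ψ := by
    constructor
    · rw [injective_iff_map_eq_zero]
      intro φ hφ
      ext ⟨_, y, hy, rfl⟩
      obtain ⟨x, hx⟩ := (hrange (y * e)).2 ⟨J.mul_mem_right _ hy, by rw [mul_assoc, he.eq]⟩
      have h1 := hsk _ (LinearMap.congr_fun hφ x)
      have h2 : q x = W₂.mkQ ⟨p y, y, hy, rfl⟩ := by
        simp only [q, hx, hp]
      rw [h2] at h1
      exact h1
    · intro g
      let E : k ≃ₗ[k] S := LinearEquiv.ofBijective (LinearMap.toSpanSingleton k S s)
        ⟨(injective_iff_map_eq_zero _).2 hsk, hspan⟩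
      have hE (t : S) : E.symm t • s = t := E.apply_symm_apply t
      let ιE : K ≃ₗ[A] LinearMap.range ι := LinearEquiv.ofInjective ι hι
      have hWr (w : W) : (w : A) ∈ LinearMap.range ι := by
        obtain ⟨_, y, hy, rfl⟩ := w
        have h : f * (y * e) ∈ J ∧ f * (y * e) * e = f * (y * e) :=
          ⟨J.mul_mem_left _ (J.mul_mem_right _ hy), by rw [mul_assoc, mul_assoc, he.eq]⟩
        exact (hrange _).2 h
      let l : W →ₗ[k] S :=
        { toFun := fun w => g (ιE.symm ⟨w, hWr w⟩)
          map_add' := fun w w' => by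
            rw [← map_add, ← map_add]; rfl
          map_smul' := fun c w => by
            rw [RingHom.id_apply, ← algebraMap_smul A c (g _), ← map_smul, ← map_smul]
            congr 2
            ext
            simp [Algebra.smul_def] }
      have hl (w : W) (x : K) (h : ι x = w) : l w = g x := by
        change g _ = g x
        congr 1
        rw [LinearEquiv.symm_apply_eq]
        ext
        exact h.symm
      have hJS (a : A) (ha : a ∈ J) (t : S) : a • t = 0 := by
        obtain ⟨c, rfl⟩ := hspan t
        rw [smul_comm, hJ a ha, smul_zero]
      have hl₂ : W₂ ≤ LinearMap.ker (E.symm.toLinearMap ∘ₗ l) := by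
        rintro w ⟨y, hy, hyw⟩
        rw [LinearMap.mem_ker, LinearMap.comp_apply, LinearEquiv.coe_coe,
          LinearEquiv.map_eq_zero_iff]
        have key : ∀ y ∈ J.restrictScalars k ^ 2, ∃ x : K, ι x = f * (y * e) ∧ g x = 0 := by
          intro y hy
          rw [pow_two] at hy
          induction hy using Submodule.mul_induction_on' with
          | mem_mul_mem a ha b hb =>
            obtain ⟨x, hx⟩ := (hrange (b * e)).2 ⟨J.mul_mem_right _ hb, by rw [mul_assoc, he.eq]⟩
            refine ⟨(f * a) • x, by simp [hx, mul_assoc], ?_⟩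
            rw [map_smul, hJS _ (J.mul_mem_left _ ha)]
          | add a _ b _ h1 h2 =>
            obtain ⟨x, hx, hx'⟩ := h1
            obtain ⟨x', hx2, hx2'⟩ := h2
            exact ⟨x + x', by rw [map_add, hx, hx2, add_mul, mul_add],
              by rw [map_add, hx', hx2', add_zero]⟩
        obtain ⟨x, hx, hx'⟩ := key y hy
        rw [hl w x (hx.trans hyw), hx']
      refine ⟨W₂.liftQ (E.symm.toLinearMap ∘ₗ l) hl₂, ?_⟩
      ext x
      change E.symm (l ⟨f * ι x, hW x⟩) • s = g x
      rw [hE, hl _ (f • x) (by simp), map_smul]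
      obtain ⟨c, hc⟩ := hspan (g x)
      rw [← hc, smul_comm, hfs]
  rw [← (LinearEquiv.ofBijective Ψ hΨ).finrank_eq, Subspace.dual_finrank_eq]

/-- The morphisms `K ⟶ S` in `ModuleCat A`, for `K ≅ Je` and `S = k s` as in
`finrank_linearMap_eq_finrank_quotient`. -/
theorem finrank_hom_eq_finrank_quotient {e f : A} (he : IsIdempotentElem e)
    (hf : IsIdempotentElem f)
    (hfa : ∀ a : A, ∃ c : k, f * a - c • f ∈ (⊥ : Ideal A).jacobson)
    {K S : ModuleCat A} (ι : K →ₗ[A] A) (hι : Function.Injective ι)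
    (hrange : ∀ x, x ∈ LinearMap.range ι ↔ x ∈ (⊥ : Ideal A).jacobson ∧ x * e = x)
    {s : S} (hs0 : s ≠ 0) (hspan : ∀ t : S, ∃ c : k, algebraMap k A c • s = t)
    (hfs : f • s = s) (hJ : ∀ a ∈ (⊥ : Ideal A).jacobson, a • s = 0) :
    Module.finrank k (K ⟶ S) =
      Module.finrank k
        (↥(Submodule.map (LinearMap.mulLeft k f ∘ₗ LinearMap.mulRight k e)
            (((⊥ : Ideal A).jacobson).restrictScalars k)) ⧸
          Submodule.comap
            (Submodule.map (LinearMap.mulLeft k f ∘ₗ LinearMap.mulRight k e)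
              (((⊥ : Ideal A).jacobson).restrictScalars k)).subtype
            (Submodule.map (LinearMap.mulLeft k f ∘ₗ LinearMap.mulRight k e)
              ((((⊥ : Ideal A).jacobson).restrictScalars k) ^ 2))) := by
  let _ : Module k S := ModuleCat.moduleOfAlgebraModule S
  have : IsScalarTower k A S := ModuleCat.isScalarTower_of_algebra_moduleCat S
  exact (ModuleCat.homLinearEquiv (S := k) (M := K) (N := S)).finrank_eq.trans
    (finrank_linearMap_eq_finrank_quotient he hf hfa ι hι hrange hs0 hspan hfs hJ)

end HomToSimple

/-- Let `A` be a finite-dimensional basic algebra over an algebraically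
closed field `k`, with radical `r` and a complete set of primitive orthogonal idempotents
`ε₁, …, ε_n` with `1 = ε₁ + ⋯ + ε_n`.  Then for the simple modules `S_i = Aε_i / rε_i`,
one has `dim_k Ext¹_A(S_i, S_j) = dim_k (ε_j (r/r²) ε_i)`, where the right-hand space is
realised as `(ε_j r ε_i)/(ε_j r² ε_i)`. -/
theorem stmt12 (k : Type) [Field k] [IsAlgClosed k] (A : Type) [Ring A] [Algebra k A]
    [FiniteDimensional k A] (n : ℕ) (ε : Fin n → A)
    (hidem : ∀ i, IsIdempotentElem (ε i))
    (horth : ∀ i j, i ≠ j → ε i * ε j = 0)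
    (hsum : ∑ i, ε i = 1)
    (hprim : ∀ i, ε i ≠ 0 ∧ ∀ f g : A, IsIdempotentElem f → IsIdempotentElem g →
      f * g = 0 → g * f = 0 → f + g = ε i → f = 0 ∨ g = 0)
    (hbasic : ∀ i j, i ≠ j →
      IsEmpty ((↥(Ideal.span {ε i} : Ideal A)) ≃ₗ[A] ↥(Ideal.span {ε j} : Ideal A))) :
    ∀ i j : Fin n,
      Module.finrank k
        (((Ext k (ModuleCat.{0} A) 1).obj
            (Opposite.op (ModuleCat.of A
              (↥(Ideal.span {ε i} : Ideal A) ⧸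
                Submodule.comap (Ideal.span {ε i} : Ideal A).subtype
                  (⊥ : Ideal A).jacobson)))).obj
          (ModuleCat.of A
            (↥(Ideal.span {ε j} : Ideal A) ⧸
              Submodule.comap (Ideal.span {ε j} : Ideal A).subtype
                (⊥ : Ideal A).jacobson))) =
      Module.finrank k
        (↥(Submodule.map (LinearMap.mulLeft k (ε j) ∘ₗ LinearMap.mulRight k (ε i))
            (((⊥ : Ideal A).jacobson).restrictScalars k)) ⧸
          Submodule.comap
            (Submodule.map (LinearMap.mulLeft k (ε j) ∘ₗ LinearMap.mulRight k (ε i))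
              (((⊥ : Ideal A).jacobson).restrictScalars k)).subtype
            (Submodule.map (LinearMap.mulLeft k (ε j) ∘ₗ LinearMap.mulRight k (ε i))
              ((((⊥ : Ideal A).jacobson).restrictScalars k) ^ 2))) := by
  intro i j
  have hP (i : Fin n) : IsPrimitiveIdem (ε i) := ⟨hidem i, (hprim i).1, (hprim i).2⟩
  have hmem {i : Fin n} {x : A} := mem_span_idem_iff (hidem i) (x := x)
  set J : Ideal A := (⊥ : Ideal A).jacobson
  have hoff (a : A) {i j : Fin n} (hij : i ≠ j) : ε i * a * ε j ∈ J :=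
    (hP i).mul_mul_mem_jacobson (k := k) (hP j) (hbasic i j hij) a
  have hcentral (a : A) : ∃ c : k, ε j * a - c • ε j ∈ J ∧ a * ε j - c • ε j ∈ J := by
    obtain ⟨c, hc⟩ := (hP j).exists_sub_smul_mem_jacobson (k := k) a
    refine ⟨c, ?_, ?_⟩
    · have h : ε j * a - c • ε j =
          (ε j * a * ε j - c • ε j) + ∑ l ∈ Finset.univ.erase j, ε j * a * ε l := by
        rw [sub_add_eq_add_sub, Finset.add_sum_erase _ (fun l => ε j * a * ε l) (Finset.mem_univ j), ← Finset.mul_sum,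
          hsum, mul_one]
      rw [h]
      exact J.add_mem hc (J.sum_mem fun l hl => hoff a (Finset.ne_of_mem_erase hl).symm)
    · have h : a * ε j - c • ε j =
          (ε j * a * ε j - c • ε j) + ∑ l ∈ Finset.univ.erase j, ε l * a * ε j := by
        rw [sub_add_eq_add_sub, Finset.add_sum_erase _ (fun l => ε l * a * ε j)
          (Finset.mem_univ j), ← Finset.sum_mul, ← Finset.sum_mul, hsum, one_mul]
      rw [h]
      exact J.add_mem hc (J.sum_mem fun l hl => hoff a (Finset.ne_of_mem_erase hl))
  set I : Fin n → Ideal A := fun i => Ideal.span {ε i}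
  let N (i : Fin n) : Submodule A (I i) := Submodule.comap (I i).subtype J
  let gen (i : Fin n) : I i := ⟨ε i, Ideal.mem_span_singleton_self _⟩
  have hgen {i : Fin n} (x : I i) : x = (x : A) • gen i := Subtype.ext (hmem.1 x.2).symm
  have hJS (a : A) (ha : a ∈ J) (t : I j ⧸ N j) : a • t = 0 := by
    obtain ⟨t, rfl⟩ := Submodule.mkQ_surjective _ t
    rw [← map_smul]
    exact (Submodule.Quotient.mk_eq_zero _).2 (J.mul_mem_right _ ha)
  have : Module.Projective A (I i) :=
    Module.Projective.of_split (I i).subtype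
      ((LinearMap.toSpanSingleton A A (ε i)).codRestrict (I i)
        fun x => Ideal.mem_span_singleton'.2 ⟨x, rfl⟩)
      (by ext x; exact hmem.1 x.2)
  have : Projective (ModuleCat.of A (I i)) :=
    (IsProjective.iff_projective (R := A) (I i)).1 this
  refine (finrank_ext_one_eq (ModuleCat.ofHom (N i).subtype) (ModuleCat.ofHom (N i).mkQ)
    (N i).injective_subtype (LinearMap.exact_subtype_mkQ _) (N i).mkQ_surjective ?_).trans ?_
  · intro g
    ext x
    change g.hom (x : I i) = 0
    rw [hgen (x : I i), map_smul]
    exact hJS _ x.2 _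
  · refine finrank_hom_eq_finrank_quotient (K := ModuleCat.of A (N i))
      (S := ModuleCat.of A (I j ⧸ N j)) (hidem i) (hidem j)
      (fun a => (hcentral a).imp fun _ h => h.1)
      ((I i).subtype ∘ₗ (N i).subtype) ?_ ?_ (s := (N j).mkQ (gen j)) ?_ ?_ ?_ ?_
    · exact (I i).injective_subtype.comp (N i).injective_subtype
    · intro x
      constructor
      · rintro ⟨y, rfl⟩
        exact ⟨y.2, hmem.1 (y : I i).2⟩
      · rintro ⟨hx, hx'⟩
        exact ⟨⟨⟨x, hmem.2 hx'⟩, hx⟩, rfl⟩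
    · intro h
      exact (hP j).notMem_jacobson ((Submodule.Quotient.mk_eq_zero (N j)).1 h)
    · intro t
      obtain ⟨x, rfl⟩ := (N j).mkQ_surjective t
      obtain ⟨c, -, hc⟩ := hcentral (x : A)
      refine ⟨c, ?_⟩
      rw [← map_smul, eq_comm]
      refine (Submodule.Quotient.eq (N j)).2 ?_
      change (x : A) - algebraMap k A c * ε j ∈ J
      rwa [← Algebra.smul_def, ← hmem.1 x.2]
    · rw [← map_smul, ← hgen (gen j)]
    · exact fun a ha => hJS a ha _
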